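/- In the setting of a Cordes coefficient family: if u₁, u₂ : ℝⁿ → ℝ are both smooth, ℤⁿ-periodic, and satisfy F_γ[u₁](y) = 0 and F_γ[u₂](y) = 0 for all y ∈ ℝⁿ, then u₁ = u₂ (uniqueness of smooth periodic strong solutions of the periodic Hamilton–Jacobi–Bellman–Isaacs problem). -/

import Mathlib

open MeasureTheory Matrix BigOperators

/-- Frobenius inner product `A : M = tr(Aᵀ M)` of two real `n × n` matrices. -/
noncomputable def fip {n : ℕ} (A M : Matrix (Fin n) (Fin n) ℝ) : ℝ := (Aᵀ * M).trace

/-- Renormalization function `γ = (tr A + c/λ) / (|A|² + |b|²/(2λ) + c²/λ²)`. -/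
noncomputable def gam {n : ℕ} (lam : ℝ) (A : Matrix (Fin n) (Fin n) ℝ)
    (b : Fin n → ℝ) (c : ℝ) : ℝ :=
  (A.trace + c / lam) / (fip A A + (∑ i, b i ^ 2) / (2 * lam) + c ^ 2 / lam ^ 2)

/-- Partial derivative `∂v/∂xᵢ` of a function on `ℝⁿ = Fin n → ℝ`. -/
noncomputable def pd {n : ℕ} (i : Fin n) (v : (Fin n → ℝ) → ℝ) (x : Fin n → ℝ) : ℝ :=
  fderiv ℝ v x (Pi.single i 1)

/-- Hessian matrix of a function on `ℝⁿ`. -/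
noncomputable def hess {n : ℕ} (v : (Fin n → ℝ) → ℝ) (x : Fin n → ℝ) :
    Matrix (Fin n) (Fin n) ℝ :=
  Matrix.of fun i j => pd i (pd j v) x

/-- The operator `L_λ v = λ v − Δ v`. -/
noncomputable def Llam {n : ℕ} (lam : ℝ) (v : (Fin n → ℝ) → ℝ) (x : Fin n → ℝ) : ℝ :=
  lam * v x - ∑ i, pd i (pd i v) x

/-- `ℤⁿ`-periodicity of a function on `ℝⁿ`. -/
def ZPeriodic {n : ℕ} (v : (Fin n → ℝ) → ℝ) : Prop :=
  ∀ (x : Fin n → ℝ) (z : Fin n → ℤ), v (x + fun i => (z i : ℝ)) = v x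

/-- The renormalized HJBI operator
`F_γ[v](y) = inf_α sup_β γ·(−A:∇²v − b·∇v + c v − f)` evaluated at `(y,α,β)`. -/
noncomputable def Fgam {n : ℕ} {𝒜 ℬ : Type} (lam : ℝ)
    (A : (Fin n → ℝ) × 𝒜 × ℬ → Matrix (Fin n) (Fin n) ℝ)
    (b : (Fin n → ℝ) × 𝒜 × ℬ → Fin n → ℝ)
    (c f : (Fin n → ℝ) × 𝒜 × ℬ → ℝ)
    (v : (Fin n → ℝ) → ℝ) (y : Fin n → ℝ) : ℝ :=
  ⨅ α : 𝒜, ⨆ β : ℬ,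
    gam lam (A (y, α, β)) (b (y, α, β)) (c (y, α, β)) *
      (-(fip (A (y, α, β)) (hess v y)) - (∑ i, b (y, α, β) i * pd i v y)
        + c (y, α, β) * v y - f (y, α, β))


lemma cordes_scalar {k δ N s e B : ℝ} (hk : 0 ≤ k) (hδ : 0 < δ) (hc : 0 < e)
    (hB : 0 ≤ B) (hN : 0 ≤ N)
    (hs : s ^ 2 ≤ (k + 1) * N)
    (h : N + B + e ^ 2 ≤ (1 / (k + 1 + δ)) * (s + e) ^ 2) : 0 < s + e := by
  have h1 : (k + 1 + δ) * (N + B + e ^ 2) ≤ (s + e) ^ 2 := by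
    have hp : 0 < k + 1 + δ := by linarith
    calc _ ≤ (k + 1 + δ) * ((1 / (k + 1 + δ)) * (s + e) ^ 2) := by gcongr
      _ = _ := by field_simp
  by_contra hcon
  push Not at hcon
  have h2 : (s + e) ^ 2 ≤ s ^ 2 := by nlinarith
  have : 0 < e ^ 2 := by positivity
  have : 0 ≤ (k+1) * B := by positivity
  have : 0 ≤ (k+1) * e^2 := by positivity
  have : 0 < δ * (N + B + e ^ 2) := by positivity
  nlinarith

lemma cordes_scalar2 {k δ N s d e B : ℝ} (hk : 0 ≤ k) (hδ : 0 < δ) (hc : 0 < e)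
    (hB : 0 ≤ B) (hN : 0 ≤ N) (hd : d ^ 2 ≤ k * N) (hpos : 0 < s + e)
    (h : N + B + e ^ 2 ≤ (1 / (k + 1 + δ)) * (s + e) ^ 2) : d ≤ s := by
  have h1 : (k + 1 + δ) * (N + B + e ^ 2) ≤ (s + e) ^ 2 := by
    have hp : 0 < k + 1 + δ := by linarith
    calc _ ≤ (k + 1 + δ) * ((1 / (k + 1 + δ)) * (s + e) ^ 2) := by gcongr
      _ = _ := by field_simp
  by_contra hcon
  push Not at hcon
  have h2 : (s + e) ^ 2 ≤ (d + e) ^ 2 := by nlinarith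
  have h3 : (d + e) ^ 2 ≤ (k + 1) * (N + e ^ 2) := by
    have : 0 ≤ k * e ^ 2 - 2 * d * e + N := by
      rcases hk.eq_or_lt with h0 | h0
      · subst h0
        have : d = 0 := by nlinarith
        subst this; simpa using hN
      · have : 0 ≤ k * (k * e ^ 2 - 2 * d * e + N) := by nlinarith [sq_nonneg (k * e - d)]
        exact nonneg_of_mul_nonneg_right this h0
    nlinarith
  have : 0 ≤ (k+1) * B := by positivity
  have : 0 < δ * (N + B + e ^ 2) := by positivity
  nlinarith

lemma fip_eq {n : ℕ} (A M : Matrix (Fin n) (Fin n) ℝ) :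
    fip A M = ∑ p : Fin n × Fin n, A p.1 p.2 * M p.1 p.2 := by
  rw [Fintype.sum_prod_type, Finset.sum_comm]
  simp [fip, Matrix.trace, Matrix.mul_apply]

lemma fip_cs {n : ℕ} (A M : Matrix (Fin n) (Fin n) ℝ) :
    fip A M ^ 2 ≤ fip A A * fip M M := by
  simp only [fip_eq, ← pow_two]
  exact Finset.sum_mul_sq_le_sq_mul_sq _ _ _

lemma fip_self_nonneg {n : ℕ} (A : Matrix (Fin n) (Fin n) ℝ) : 0 ≤ fip A A := by
  rw [fip_eq]; exact Finset.sum_nonneg fun p _ => mul_self_nonneg _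

lemma cordes_pos {n : ℕ} (hn : 1 ≤ n) (lam δ : ℝ) (hlam : 0 < lam) (hδ : 0 < δ)
    (A : Matrix (Fin n) (Fin n) ℝ) (b : Fin n → ℝ) (c : ℝ) (hA : A.IsSymm) (hc : 0 < c)
    (h : fip A A + (∑ i, b i ^ 2) / (2 * lam) + c ^ 2 / lam ^ 2
      ≤ (1 / ((n : ℝ) + δ)) * (A.trace + c / lam) ^ 2) :
    0 < gam lam A b c ∧ A.PosSemidef := by
  have hB : 0 ≤ (∑ i, b i ^ 2) / (2 * lam) :=
    div_nonneg (Finset.sum_nonneg fun i _ => sq_nonneg _) (by positivity)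
  have hN := fip_self_nonneg A
  have he : 0 < c / lam := by positivity
  have hk : (0 : ℝ) ≤ (n : ℝ) - 1 := by
    have : (1 : ℝ) ≤ n := by exact_mod_cast hn
    linarith
  have h' : fip A A + (∑ i, b i ^ 2) / (2 * lam) + (c / lam) ^ 2
      ≤ (1 / (((n : ℝ) - 1) + 1 + δ)) * (A.trace + c / lam) ^ 2 := by
    rw [div_pow]; convert h using 3; ring
  have hs : A.trace ^ 2 ≤ (((n : ℝ) - 1) + 1) * fip A A := by
    have := fip_cs 1 A
    simp [fip] at this ⊢
    linarith
  have hpos : 0 < A.trace + c / lam := cordes_scalar hk hδ he hB hN hs h'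
  refine ⟨?_, ?_⟩
  · unfold gam
    have : 0 < c ^ 2 / lam ^ 2 := by positivity
    positivity
  · refine Matrix.PosSemidef.of_dotProduct_mulVec_nonneg (by simpa [Matrix.IsHermitian, Matrix.IsSymm] using hA) ?_
    intro x
    simp only [star_trivial]
    by_cases hx : x = 0
    · simp [hx]
    have hr : 0 < x ⬝ᵥ x := by
      have h0 : 0 ≤ x ⬝ᵥ x := Finset.sum_nonneg fun i _ => mul_self_nonneg _
      exact lt_of_le_of_ne h0 (fun h => hx (dotProduct_self_eq_zero.mp h.symm))
    set r := x ⬝ᵥ x with hrdef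
    set M : Matrix (Fin n) (Fin n) ℝ := r • 1 - vecMulVec x x with hM
    have hAM : fip A M = r * A.trace - x ⬝ᵥ A *ᵥ x := by
      have e1 : fip A M = (A * M).trace := by unfold fip; rw [hA.eq]
      rw [e1, hM, Matrix.mul_sub, Matrix.trace_sub, Matrix.mul_vecMulVec, Matrix.trace_vecMulVec,
        dotProduct_comm]
      simp
    have hMM : fip M M = ((n : ℝ) - 1) * r ^ 2 := by
      have e1 : Mᵀ = M := by simp [hM, Matrix.transpose_vecMulVec]
      have e2 : M *ᵥ x = 0 := by
        rw [hM, Matrix.sub_mulVec, Matrix.vecMulVec_mulVec]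
        ext i; simp [Matrix.smul_mulVec, ← hrdef, mul_comm]
      unfold fip
      rw [e1]
      nth_rw 2 [hM]
      rw [Matrix.mul_sub, Matrix.trace_sub, Matrix.mul_vecMulVec, e2, hM]
      simp [Matrix.trace_vecMulVec, ← hrdef]
      ring
    have hcs := fip_cs A M
    rw [hAM, hMM] at hcs
    have hd : (A.trace - (x ⬝ᵥ A *ᵥ x) / r) ^ 2 ≤ ((n : ℝ) - 1) * fip A A := by
      have e : A.trace - (x ⬝ᵥ A *ᵥ x) / r = (r * A.trace - x ⬝ᵥ A *ᵥ x) / r := by field_simp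
      rw [e, div_pow, div_le_iff₀ (by positivity)]
      linarith
    have := cordes_scalar2 hk hδ he hB hN hd hpos h'
    have h3 : 0 ≤ (x ⬝ᵥ A *ᵥ x) / r := by linarith
    have h4 := mul_nonneg h3 hr.le
    rwa [div_mul_cancel₀ _ hr.ne'] at h4

lemma fip_nonpos {n : ℕ} (A H : Matrix (Fin n) (Fin n) ℝ) (hA : A.PosSemidef)
    (hH : ∀ x, x ⬝ᵥ H *ᵥ x ≤ 0) : fip A H ≤ 0 := by
  obtain ⟨m, v, rfl⟩ := Matrix.posSemidef_iff_eq_sum_vecMulVec.mp hA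
  have e : fip (∑ k, vecMulVec (v k) (star (v k))) H = ∑ k, (v k) ⬝ᵥ H *ᵥ (v k) := by
    unfold fip
    rw [Matrix.transpose_sum, Matrix.sum_mul, Matrix.trace_sum]
    refine Finset.sum_congr rfl fun k _ => ?_
    rw [star_trivial, Matrix.transpose_vecMulVec, Matrix.trace_mul_comm, Matrix.mul_vecMulVec,
      Matrix.trace_vecMulVec, dotProduct_comm]
  rw [e]
  exact Finset.sum_nonpos fun k _ => hH _

lemma second_deriv_nonpos (g : ℝ → ℝ) (hg : ContDiff ℝ 2 g) (hmax : IsLocalMax g 0) :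
    deriv (deriv g) 0 ≤ 0 := by
  by_contra hcon
  push Not at hcon
  have h1 := isLocalMin_of_deriv_deriv_pos hcon hmax.deriv_eq_zero hg.continuous.continuousAt
  have h2 : g =ᶠ[nhds 0] fun _ => g 0 := by
    filter_upwards [h1, hmax] with t a b using le_antisymm b a
  have h3 := h2.deriv.deriv_eq
  simp at h3
  linarith

lemma fderiv_eq_sum_pd {n : ℕ} (w : (Fin n → ℝ) → ℝ) (y x : Fin n → ℝ) :
    fderiv ℝ w y x = ∑ i, x i * pd i w y := by
  conv_lhs => rw [pi_eq_sum_univ' x]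
  simp [pd, map_sum]

lemma pd_contDiff {n : ℕ} {w : (Fin n → ℝ) → ℝ} (hw : ContDiff ℝ (⊤ : ℕ∞) w) (i : Fin n) :
    ContDiff ℝ (⊤ : ℕ∞) (pd i w) := by
  unfold pd
  exact (hw.fderiv_right (m := (⊤ : ℕ∞)) (by simp)).clm_apply contDiff_const

lemma line_deriv {n : ℕ} {w : (Fin n → ℝ) → ℝ} (hw : ContDiff ℝ (⊤ : ℕ∞) w) (y x : Fin n → ℝ)
    (t : ℝ) : HasDerivAt (fun t : ℝ => w (y + t • x)) (∑ i, x i * pd i w (y + t • x)) t := by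
  rw [← fderiv_eq_sum_pd]
  have h1 : HasDerivAt (fun t : ℝ => y + t • x) x t := by
    simpa using ((hasDerivAt_id t).smul_const x).const_add y
  exact ((hw.differentiable (by simp)) _).hasFDerivAt.comp_hasDerivAt t h1

lemma hess_nonpos {n : ℕ} {w : (Fin n → ℝ) → ℝ} (hw : ContDiff ℝ (⊤ : ℕ∞) w) (y : Fin n → ℝ)
    (hmax : ∀ z, w z ≤ w y) (x : Fin n → ℝ) : x ⬝ᵥ hess w y *ᵥ x ≤ 0 := by
  have h1 : deriv (fun t : ℝ => w (y + t • x)) = fun t => ∑ i, x i * pd i w (y + t • x) :=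
    funext fun t => (line_deriv hw y x t).deriv
  have h2 : deriv (deriv (fun t : ℝ => w (y + t • x))) 0
      = ∑ j, x j * ∑ i, x i * pd i (pd j w) (y + (0:ℝ) • x) := by
    rw [h1]
    refine HasDerivAt.deriv ?_
    exact HasDerivAt.fun_sum fun j _ => (line_deriv (pd_contDiff hw j) y x 0).const_mul (x j)
  have h3 := second_deriv_nonpos (fun t : ℝ => w (y + t • x))
    ((hw.of_le (by exact WithTop.coe_le_coe.mpr (le_top : (2 : ℕ∞) ≤ ⊤))).comp (by fun_prop))
    (Filter.Eventually.of_forall fun t => by simpa using hmax _)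
  rw [h2] at h3
  refine le_trans (le_of_eq ?_) h3
  simp only [dotProduct, Matrix.mulVec, hess, Matrix.of_apply, Finset.mul_sum, zero_smul, add_zero]
  rw [Finset.sum_comm]
  refine Finset.sum_congr rfl fun j _ => Finset.sum_congr rfl fun i _ => by ring

lemma exists_max {n : ℕ} {w : (Fin n → ℝ) → ℝ} (hw : Continuous w) (hp : ZPeriodic w) :
    ∃ y, ∀ z, w z ≤ w y := by
  obtain ⟨y, -, hy⟩ := (isCompact_Icc (a := (0 : Fin n → ℝ)) (b := 1)).exists_isMaxOn
    ⟨0, by simp⟩ hw.continuousOn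
  refine ⟨y, fun z => ?_⟩
  have h := hp (fun i => Int.fract (z i)) (fun i => ⌊z i⌋)
  have e : ((fun i => Int.fract (z i)) + fun i => ((⌊z i⌋ : ℤ) : ℝ)) = z := by
    ext i; simp
  rw [e] at h
  rw [h]
  exact hy ⟨fun i => Int.fract_nonneg _, fun i => (Int.fract_lt_one _).le⟩

lemma pd_sub' {n : ℕ} {u v : (Fin n → ℝ) → ℝ} (hu : ContDiff ℝ (⊤ : ℕ∞) u)
    (hv : ContDiff ℝ (⊤ : ℕ∞) v) (i : Fin n) :
    pd i (fun x => u x - v x) = fun x => pd i u x - pd i v x := by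
  ext x
  unfold pd
  rw [fderiv_fun_sub (hu.differentiable (by simp) _) (hv.differentiable (by simp) _)]
  rfl

lemma infsup_gap {𝒜 ℬ : Type} [MetricSpace 𝒜] [CompactSpace 𝒜] [Nonempty 𝒜]
    [MetricSpace ℬ] [CompactSpace ℬ] [Nonempty ℬ] (g₁ g₂ : 𝒜 × ℬ → ℝ)
    (h₁ : Continuous g₁) (h₂ : Continuous g₂) (h : ∀ q, g₂ q < g₁ q) :
    (⨅ α, ⨆ β, g₂ (α, β)) < ⨅ α, ⨆ β, g₁ (α, β) := by
  obtain ⟨q₀, -, hq₀⟩ := isCompact_univ.exists_isMinOn Set.univ_nonempty (h₁.sub h₂).continuousOn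
  have hb (g : 𝒜 × ℬ → ℝ) (hg : Continuous g) (α : 𝒜) :
      BddAbove (Set.range fun β => g (α, β)) :=
    (isCompact_range (by fun_prop)).bddAbove
  obtain ⟨m, hm⟩ := (isCompact_range h₂).bddBelow
  have key : (⨅ α, ⨆ β, g₂ (α, β)) + (g₁ q₀ - g₂ q₀) ≤ ⨅ α, ⨆ β, g₁ (α, β) := by
    refine le_ciInf fun α => ?_
    have hl : (⨅ α, ⨆ β, g₂ (α, β)) ≤ ⨆ β, g₂ (α, β) := by
      refine ciInf_le ⟨m, ?_⟩ α
      rintro _ ⟨α, rfl⟩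
      have β : ℬ := Classical.arbitrary ℬ
      exact (hm ⟨(α, β), rfl⟩).trans (le_ciSup (hb g₂ h₂ α) β)
    have hu : (⨆ β, g₂ (α, β)) ≤ (⨆ β, g₁ (α, β)) - (g₁ q₀ - g₂ q₀) := by
      refine ciSup_le fun β => ?_
      have a1 := le_ciSup (hb g₁ h₁ α) β
      have a2 := isMinOn_iff.mp hq₀ (α, β) (Set.mem_univ _)
      simp only [Pi.sub_apply] at a1 a2
      linarith
    linarith
  have := h q₀
  linarith

lemma comparison {n : ℕ} (hn : 1 ≤ n) (lam δ : ℝ) (hlam : 0 < lam) (hδ : 0 < δ)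
    (𝒜 ℬ : Type) [MetricSpace 𝒜] [CompactSpace 𝒜] [Nonempty 𝒜]
    [MetricSpace ℬ] [CompactSpace ℬ] [Nonempty ℬ]
    (A : (Fin n → ℝ) × 𝒜 × ℬ → Matrix (Fin n) (Fin n) ℝ)
    (b : (Fin n → ℝ) × 𝒜 × ℬ → Fin n → ℝ)
    (c f : (Fin n → ℝ) × 𝒜 × ℬ → ℝ)
    (hAc : Continuous A) (hbc : Continuous b) (hcc : Continuous c) (hfc : Continuous f)
    (hAsymm : ∀ q, (A q).IsSymm)
    (hcpos : ∀ q, 0 < c q)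
    (hCordes : ∀ q, fip (A q) (A q) + (∑ i, b q i ^ 2) / (2 * lam) + c q ^ 2 / lam ^ 2
      ≤ (1 / ((n : ℝ) + δ)) * ((A q).trace + c q / lam) ^ 2)
    (u₁ u₂ : (Fin n → ℝ) → ℝ)
    (hu₁ : ContDiff ℝ (⊤ : ℕ∞) u₁) (hu₂ : ContDiff ℝ (⊤ : ℕ∞) u₂)
    (hp₁ : ZPeriodic u₁) (hp₂ : ZPeriodic u₂)
    (hsol₁ : ∀ y : Fin n → ℝ, Fgam lam A b c f u₁ y = 0)
    (hsol₂ : ∀ y : Fin n → ℝ, Fgam lam A b c f u₂ y = 0) (x : Fin n → ℝ) :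
    u₁ x ≤ u₂ x := by
  set w : (Fin n → ℝ) → ℝ := fun x => u₁ x - u₂ x with hwdef
  have hw : ContDiff ℝ (⊤ : ℕ∞) w := hu₁.sub hu₂
  obtain ⟨y, hy⟩ := exists_max hw.continuous (fun x z => by simp only [hwdef, hp₁ x z, hp₂ x z])
  by_contra hcon
  push Not at hcon
  have hwy : 0 < u₁ y - u₂ y := by
    have := hy x
    simp only [hwdef] at this
    linarith
  have hgrad : ∀ i, pd i u₁ y = pd i u₂ y := by
    intro i
    have h0 : fderiv ℝ w y = 0 := IsLocalMax.fderiv_eq_zero (Filter.Eventually.of_forall hy)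
    have h1 := congrFun (pd_sub' hu₁ hu₂ i) y
    have h2 : pd i w y = 0 := by simp [pd, h0]
    rw [← hwdef, h2] at h1
    linarith
  have hhess : hess u₁ y = hess u₂ y + hess w y := by
    ext i j
    have h1 : pd j w = fun x => pd j u₁ x - pd j u₂ x := pd_sub' hu₁ hu₂ j
    have h2 := congrFun (pd_sub' (pd_contDiff hu₁ j) (pd_contDiff hu₂ j) i) y
    simp only [hess, Matrix.add_apply, Matrix.of_apply]
    rw [h1, h2]; ring
  have hH := hess_nonpos hw y hy
  have hcp := fun q => cordes_pos hn lam δ hlam hδ (A q) (b q) (c q) (hAsymm q) (hcpos q) (hCordes q)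
  have hfip (M : Matrix (Fin n) (Fin n) ℝ) : Continuous fun q => fip (A q) M := by
    unfold fip; fun_prop
  have hgam : Continuous fun q => gam lam (A q) (b q) (c q) := by
    unfold gam
    refine Continuous.div (by fun_prop) ?_ fun q => ?_
    · unfold fip; fun_prop
    · have := hcpos q
      have h1 := fip_self_nonneg (A q)
      have : 0 < c q ^ 2 / lam ^ 2 := by positivity
      have hB : 0 ≤ (∑ i, b q i ^ 2) / (2 * lam) :=
        div_nonneg (Finset.sum_nonneg fun i _ => sq_nonneg _) (by positivity)
      positivity
  have hcont (u : (Fin n → ℝ) → ℝ) : Continuous fun p : 𝒜 × ℬ =>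
      gam lam (A (y, p)) (b (y, p)) (c (y, p)) *
      (-(fip (A (y, p)) (hess u y)) - (∑ i, b (y, p) i * pd i u y)
        + c (y, p) * u y - f (y, p)) := by
    have e : Continuous fun p : 𝒜 × ℬ => (y, p) := by fun_prop
    have a1 := hgam.comp e
    have a2 := (hfip (hess u y)).comp e
    simp only [Function.comp_def] at a1 a2
    fun_prop
  have hgap := infsup_gap _ _ (hcont u₁) (hcont u₂) (fun p => by
    obtain ⟨hg, hP⟩ := hcp (y, p)
    refine mul_lt_mul_of_pos_left ?_ hg
    have h1 : fip (A (y, p)) (hess u₁ y)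
        = fip (A (y, p)) (hess u₂ y) + fip (A (y, p)) (hess w y) := by
      rw [hhess]; simp [fip, Matrix.mul_add]
    have h2 := fip_nonpos _ _ hP hH
    have h3 := mul_pos (hcpos (y, p)) hwy
    simp only [hgrad]
    rw [h1]
    linarith)
  have e₁ := hsol₁ y
  have e₂ := hsol₂ y
  unfold Fgam at e₁ e₂
  rw [e₁, e₂] at hgap
  exact lt_irrefl _ hgap

/-- uniqueness of smooth periodic strong solutions of the HJBI problem. -/
theorem stmt11 {n : ℕ} (hn : 1 ≤ n) (lam δ : ℝ) (hlam : 0 < lam)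
    (hδ : δ ∈ Set.Ioo (0 : ℝ) 1)
    (𝒜 ℬ : Type) [MetricSpace 𝒜] [CompactSpace 𝒜] [Nonempty 𝒜]
    [MetricSpace ℬ] [CompactSpace ℬ] [Nonempty ℬ]
    (A : (Fin n → ℝ) × 𝒜 × ℬ → Matrix (Fin n) (Fin n) ℝ)
    (b : (Fin n → ℝ) × 𝒜 × ℬ → Fin n → ℝ)
    (c f : (Fin n → ℝ) × 𝒜 × ℬ → ℝ)
    (hAc : Continuous A) (hbc : Continuous b) (hcc : Continuous c) (hfc : Continuous f)
    (hAsymm : ∀ q, (A q).IsSymm)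
    (hAper : ∀ (y : Fin n → ℝ) (z : Fin n → ℤ) (α : 𝒜) (β : ℬ),
      A ((y + fun i => (z i : ℝ)), α, β) = A (y, α, β))
    (hbper : ∀ (y : Fin n → ℝ) (z : Fin n → ℤ) (α : 𝒜) (β : ℬ),
      b ((y + fun i => (z i : ℝ)), α, β) = b (y, α, β))
    (hcper : ∀ (y : Fin n → ℝ) (z : Fin n → ℤ) (α : 𝒜) (β : ℬ),
      c ((y + fun i => (z i : ℝ)), α, β) = c (y, α, β))
    (hfper : ∀ (y : Fin n → ℝ) (z : Fin n → ℤ) (α : 𝒜) (β : ℬ),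
      f ((y + fun i => (z i : ℝ)), α, β) = f (y, α, β))
    (hcpos : ∀ q, 0 < c q)
    (hCordes : ∀ q, fip (A q) (A q) + (∑ i, b q i ^ 2) / (2 * lam) + c q ^ 2 / lam ^ 2
      ≤ (1 / ((n : ℝ) + δ)) * ((A q).trace + c q / lam) ^ 2)
    (u₁ u₂ : (Fin n → ℝ) → ℝ)
    (hu₁ : ContDiff ℝ (⊤ : ℕ∞) u₁) (hu₂ : ContDiff ℝ (⊤ : ℕ∞) u₂)
    (hp₁ : ZPeriodic u₁) (hp₂ : ZPeriodic u₂)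
    (hsol₁ : ∀ y : Fin n → ℝ, Fgam lam A b c f u₁ y = 0)
    (hsol₂ : ∀ y : Fin n → ℝ, Fgam lam A b c f u₂ y = 0) :
    u₁ = u₂ := by
  funext x
  exact le_antisymm
    (comparison hn lam δ hlam hδ.1 𝒜 ℬ A b c f hAc hbc hcc hfc hAsymm hcpos hCordes u₁ u₂
      hu₁ hu₂ hp₁ hp₂ hsol₁ hsol₂ x)
    (comparison hn lam δ hlam hδ.1 𝒜 ℬ A b c f hAc hbc hcc hfc hAsymm hcpos hCordes u₂ u₁
      hu₂ hu₁ hp₂ hp₁ hsol₂ hsol₁ x)
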